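/- arXiv:2010.05901 — 5 statements merged into one kernel-verified Lean document; each statement's English description precedes it below -/
import Mathlib

section
/- Let p and p̂ be probability vectors on the finite set {1,…,S}, let N > 0 and ι ≥ 0 be real numbers with 4ι ≤ N, and let ε₁ ∈ (0,1]. Let L be the finite grid of all vectors x ∈ [0,1]^S each of whose coordinates is an integer multiple of ε₁. Assume that for every x ∈ L both |(p − p̂)·x| ≤ √(2·𝕍(p,x)·ι/N) + ι/(3N) and |(p − p̂)·x| ≤ √(4·𝕍(p̂,x)·ι/N) + 14ι/(3N) hold. Then for every vector v ∈ [0,1]^S: |(p − p̂)·v| ≤ √(2·𝕍(p,v)·ι/N) + ι/(3N) + 3ε₁ and |(p − p̂)·v| ≤ √(4·𝕍(p̂,v)·ι/N) + 14ι/(3N) + 3ε₁. -/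
open Finset

/-- `p·v = Σᵢ pᵢ vᵢ` for vectors on `Fin S`. -/
def dot {S : ℕ} (p v : Fin S → ℝ) : ℝ := ∑ i, p i * v i

/-- `𝕍(p,v) = Σᵢ pᵢ vᵢ² − (p·v)²`. -/
def pVar {S : ℕ} (p v : Fin S → ℝ) : ℝ := (∑ i, p i * v i ^ 2) - (dot p v) ^ 2

theorem pVar_nonneg_aux {S : ℕ} (p v : Fin S → ℝ) (hp : (∀ i, 0 ≤ p i) ∧ ∑ i, p i = 1) :
    0 ≤ pVar p v := by
  have h := Finset.sum_sq_le_sum_mul_sum_of_sq_eq_mul (Finset.univ : Finset (Fin S))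
    (r := fun i => p i * v i) (f := p) (g := fun i => p i * v i ^ 2)
    (fun i _ => hp.1 i) (fun i _ => mul_nonneg (hp.1 i) (sq_nonneg _)) (fun i _ => by ring)
  rw [hp.2, one_mul] at h
  unfold pVar dot
  linarith

theorem pVar_expand_aux {S : ℕ} (p v d : Fin S → ℝ) (t : ℝ) :
    pVar p (fun i => v i - t * d i) = pVar p v
      - 2 * t * ((∑ i, p i * (v i * d i)) - dot p v * dot p d) + t ^ 2 * pVar p d := by
  have h1 : ∑ i, p i * (v i - t * d i) ^ 2 = (∑ i, p i * v i ^ 2)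
      - 2 * t * (∑ i, p i * (v i * d i)) + t ^ 2 * ∑ i, p i * d i ^ 2 := by
    rw [Finset.mul_sum, Finset.mul_sum, ← Finset.sum_sub_distrib, ← Finset.sum_add_distrib]
    exact Finset.sum_congr rfl fun i _ => by ring
  have h2 : dot p (fun i => v i - t * d i) = dot p v - t * dot p d := by
    unfold dot
    rw [Finset.mul_sum, ← Finset.sum_sub_distrib]
    exact Finset.sum_congr rfl fun i _ => by ring
  unfold pVar
  rw [h1, h2]
  ring

theorem sqrt_pVar_aux {S : ℕ} (p v d : Fin S → ℝ) (hp : (∀ i, 0 ≤ p i) ∧ ∑ i, p i = 1)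
    (c ε : ℝ) (hc : 0 ≤ c) (hc1 : c ≤ 1) (hε : 0 ≤ ε) (hd : ∀ i, 0 ≤ d i ∧ d i ≤ ε) :
    Real.sqrt (c * pVar p (fun i => v i - d i)) ≤ Real.sqrt (c * pVar p v) + ε := by
  have hV := pVar_nonneg_aux p v hp
  have hD := pVar_nonneg_aux p d hp
  have hDε : pVar p d ≤ ε ^ 2 := by
    have : ∑ i, p i * d i ^ 2 ≤ ∑ i, p i * ε ^ 2 := Finset.sum_le_sum fun i _ =>
      mul_le_mul_of_nonneg_left (pow_le_pow_left₀ (hd i).1 (hd i).2 2) (hp.1 i)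
    rw [← Finset.sum_mul, hp.2, one_mul] at this
    unfold pVar
    nlinarith [sq_nonneg (dot p d)]
  have hx := pVar_expand_aux p v d 1
  simp only [one_mul, mul_one, one_pow] at hx
  have hdisc := discrim_le_zero (a := pVar p d)
    (b := - 2 * ((∑ i, p i * (v i * d i)) - dot p v * dot p d)) (c := pVar p v) (fun t => by
      have := pVar_nonneg_aux p (fun i => v i - t * d i) hp
      rw [pVar_expand_aux] at this
      linarith)
  unfold discrim at hdisc
  rw [hx]
  generalize (∑ i, p i * (v i * d i)) - dot p v * dot p d = C at *
  have hs := Real.sq_sqrt (mul_nonneg hc hV)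
  have hs0 := Real.sqrt_nonneg (c * pVar p v)
  generalize Real.sqrt (c * pVar p v) = s at *
  have hcD : c * pVar p d ≤ ε ^ 2 := by nlinarith
  have hCC : C ^ 2 ≤ pVar p v * pVar p d := by nlinarith
  have hcov : (c * C) ^ 2 ≤ (s * ε) ^ 2 := by
    calc (c * C) ^ 2 = c ^ 2 * C ^ 2 := by ring
      _ ≤ c ^ 2 * (pVar p v * pVar p d) := mul_le_mul_of_nonneg_left hCC (sq_nonneg _)
      _ = s ^ 2 * (c * pVar p d) := by rw [hs]; ring
      _ ≤ s ^ 2 * ε ^ 2 := mul_le_mul_of_nonneg_left hcD (sq_nonneg _)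
      _ = _ := by ring
  have hab := abs_le_of_sq_le_sq' hcov (mul_nonneg hs0 hε)
  apply Real.sqrt_le_iff.2
  constructor
  · positivity
  · nlinarith [hab.1]

theorem dot_bounds_aux {S : ℕ} (p d : Fin S → ℝ) (hp : (∀ i, 0 ≤ p i) ∧ ∑ i, p i = 1)
    (ε : ℝ) (hd : ∀ i, 0 ≤ d i ∧ d i ≤ ε) : 0 ≤ dot p d ∧ dot p d ≤ ε := by
  constructor
  · exact Finset.sum_nonneg fun i _ => mul_nonneg (hp.1 i) (hd i).1
  · have : ∑ i, p i * d i ≤ ∑ i, p i * ε := Finset.sum_le_sum fun i _ =>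
      mul_le_mul_of_nonneg_left (hd i).2 (hp.1 i)
    rwa [← Finset.sum_mul, hp.2, one_mul] at this

/-- Transfer of Bernstein-type concentration from the `ε₁`-grid
`L = {x ∈ [0,1]^S : every coordinate an integer multiple of ε₁}` to all of `[0,1]^S`,
at the cost of an additive slack `3ε₁`. -/
theorem grid_to_all_concentration
    (S : ℕ) (p phat : Fin S → ℝ)
    (hp : (∀ i, 0 ≤ p i) ∧ ∑ i, p i = 1)
    (hphat : (∀ i, 0 ≤ phat i) ∧ ∑ i, phat i = 1)
    (N ι ε₁ : ℝ) (hN : 0 < N) (hι : 0 ≤ ι) (hιN : 4 * ι ≤ N)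
    (hε₁ : ε₁ ∈ Set.Ioc (0 : ℝ) 1)
    (hgrid : ∀ x : Fin S → ℝ,
      (∀ i, 0 ≤ x i ∧ x i ≤ 1 ∧ ∃ k : ℤ, x i = k * ε₁) →
      |dot (fun i => p i - phat i) x| ≤ Real.sqrt (2 * pVar p x * ι / N) + ι / (3 * N) ∧
      |dot (fun i => p i - phat i) x| ≤ Real.sqrt (4 * pVar phat x * ι / N) + 14 * ι / (3 * N)) :
    ∀ v : Fin S → ℝ, (∀ i, 0 ≤ v i ∧ v i ≤ 1) →
      |dot (fun i => p i - phat i) v| ≤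
          Real.sqrt (2 * pVar p v * ι / N) + ι / (3 * N) + 3 * ε₁ ∧
      |dot (fun i => p i - phat i) v| ≤
          Real.sqrt (4 * pVar phat v * ι / N) + 14 * ι / (3 * N) + 3 * ε₁ := by
  obtain ⟨h0, h1⟩ := hε₁
  intro v hv
  obtain ⟨d, hdef⟩ : ∃ d : Fin S → ℝ, ∀ i, d i = v i - ⌊v i / ε₁⌋ * ε₁ := ⟨_, fun _ => rfl⟩
  have hd : ∀ i, 0 ≤ d i ∧ d i ≤ ε₁ := fun i => by
    have a := Int.floor_le (v i / ε₁)
    have b := (Int.lt_floor_add_one (v i / ε₁)).le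
    rw [le_div_iff₀ h0] at a
    rw [div_le_iff₀ h0] at b
    rw [hdef]
    constructor <;> linarith
  have hg := hgrid (fun i => v i - d i) (fun i => by
    have hk : v i - d i = ⌊v i / ε₁⌋ * ε₁ := by rw [hdef]; ring
    refine ⟨?_, ?_, _, hk⟩
    · show 0 ≤ v i - d i
      rw [hk]
      have : (0 : ℤ) ≤ ⌊v i / ε₁⌋ := Int.floor_nonneg.2 (div_nonneg (hv i).1 h0.le)
      have : (0 : ℝ) ≤ ⌊v i / ε₁⌋ := by exact_mod_cast this
      positivity
    · linarith [(hv i).2, (hd i).1])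
  have hdot : dot (fun i => p i - phat i) v
      = dot (fun i => p i - phat i) (fun i => v i - d i) + (dot p d - dot phat d) := by
    unfold dot
    rw [← Finset.sum_sub_distrib, ← Finset.sum_add_distrib]
    exact Finset.sum_congr rfl fun i _ => by ring
  have hpd := dot_bounds_aux p d hp ε₁ hd
  have hqd := dot_bounds_aux phat d hphat ε₁ hd
  have hdd : |dot p d - dot phat d| ≤ ε₁ := abs_le.2 ⟨by linarith, by linarith⟩
  have htri := abs_add_le (dot (fun i => p i - phat i) (fun i => v i - d i))
    (dot p d - dot phat d)
  rw [← hdot] at htri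
  have e1 := sqrt_pVar_aux p v d hp (2 * ι / N) ε₁ (by positivity)
    (by rw [div_le_one hN]; linarith) h0.le hd
  have e2 := sqrt_pVar_aux phat v d hphat (4 * ι / N) ε₁ (by positivity)
    (by rw [div_le_one hN]; linarith) h0.le hd
  have r1 : ∀ a b : ℝ, b * ι / N * a = b * a * ι / N := fun a b => by ring
  rw [r1, r1] at e1 e2
  constructor
  · linarith [hg.1]
  · linarith [hg.2]
end

section
/- Let p and p̂ be probability vectors on the finite set {1,…,S}, and let Z > 0, n > 0, ι ≥ 0 and ε ≥ 0 be real numbers. Assume that for every u ∈ ℝ^S with 0 ≤ uᵢ ≤ Z² for all i: |(p̂ − p)·u| ≤ √(2·𝕍(p,u)·ι/n) + 3·ε·Z + Z²·ι/(3n). Then for every v ∈ ℝ^S with 0 ≤ vᵢ ≤ Z for all i: 𝕍(p̂, v) ≤ (3/2)·𝕍(p, v) + 4·Z²·ι/(3n) + 3·ε·Z. -/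
open Finset

/-- Under Bernstein-type concentration of `p̂` around `p` on test vectors bounded by
`Z²`, the empirical variance of any test vector bounded by `Z` is at most `3/2` times
the true variance plus lower-order terms. -/
theorem empirical_variance_vs_true_variance
    (S : ℕ) (p phat : Fin S → ℝ)
    (hp : (∀ i, 0 ≤ p i) ∧ ∑ i, p i = 1)
    (hphat : (∀ i, 0 ≤ phat i) ∧ ∑ i, phat i = 1)
    (Z n ι ε : ℝ) (hZ : 0 < Z) (hn : 0 < n) (hι : 0 ≤ ι) (hε : 0 ≤ ε)
    (hbd : ∀ u : Fin S → ℝ, (∀ i, 0 ≤ u i ∧ u i ≤ Z ^ 2) →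
      |dot (fun i => phat i - p i) u| ≤
        Real.sqrt (2 * pVar p u * ι / n) + 3 * ε * Z + Z ^ 2 * ι / (3 * n)) :
    ∀ v : Fin S → ℝ, (∀ i, 0 ≤ v i ∧ v i ≤ Z) →
      pVar phat v ≤ 3 / 2 * pVar p v + 4 * Z ^ 2 * ι / (3 * n) + 3 * ε * Z := by
  intro v hv
  obtain ⟨hp0, hp1⟩ := hp
  obtain ⟨hq0, hq1⟩ := hphat
  have hm0 : 0 ≤ dot p v := Finset.sum_nonneg fun i _ => mul_nonneg (hp0 i) (hv i).1
  have hmZ : dot p v ≤ Z := by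
    calc dot p v ≤ ∑ i, p i * Z :=
          Finset.sum_le_sum fun i _ => mul_le_mul_of_nonneg_left (hv i).2 (hp0 i)
      _ = Z := by rw [← Finset.sum_mul, hp1, one_mul]
  have key : ∀ (q : Fin S → ℝ) (m : ℝ), ∑ i, q i = 1 →
      ∑ i, q i * (v i - m) ^ 2 = pVar q v + (dot q v - m) ^ 2 := by
    intro q m hq
    have : ∑ i, q i * (v i - m) ^ 2
        = ∑ i, q i * v i ^ 2 - 2 * m * ∑ i, q i * v i + m ^ 2 * ∑ i, q i := by
      rw [Finset.mul_sum, Finset.mul_sum, ← Finset.sum_sub_distrib, ← Finset.sum_add_distrib]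
      exact Finset.sum_congr rfl fun i _ => by ring
    rw [this, hq]
    unfold pVar dot
    ring
  have hu : ∀ i, 0 ≤ (v i - dot p v) ^ 2 ∧ (v i - dot p v) ^ 2 ≤ Z ^ 2 := fun i =>
    ⟨sq_nonneg _, sq_le_sq' (by linarith [(hv i).1]) (by linarith [(hv i).2])⟩
  have h := hbd (fun i => (v i - dot p v) ^ 2) hu
  have hP := key p (dot p v) hp1
  have hQ := key phat (dot p v) hq1
  rw [sub_self, zero_pow two_ne_zero, add_zero] at hP
  have hV0 : 0 ≤ pVar p v := by
    rw [← hP]; exact Finset.sum_nonneg fun i _ => mul_nonneg (hp0 i) (hu i).1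
  have hd : dot (fun i => phat i - p i) (fun i => (v i - dot p v) ^ 2)
      = pVar phat v + (dot phat v - dot p v) ^ 2 - pVar p v := by
    rw [← hQ]
    conv_rhs => rw [← hP]
    rw [← Finset.sum_sub_distrib]
    exact Finset.sum_congr rfl fun i _ => by ring
  have hW : pVar p (fun i => (v i - dot p v) ^ 2) ≤ Z ^ 2 * pVar p v := by
    have h1 : ∑ i, p i * ((v i - dot p v) ^ 2) ^ 2 ≤ Z ^ 2 * pVar p v := by
      rw [← hP, Finset.mul_sum]
      refine Finset.sum_le_sum fun i _ => ?_
      have := mul_le_mul_of_nonneg_left (hu i).2 (mul_nonneg (hp0 i) (hu i).1)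
      linarith
    have h2 := sq_nonneg (dot p (fun i => (v i - dot p v) ^ 2))
    have h3 : pVar p (fun i => (v i - dot p v) ^ 2)
      = ∑ i, p i * ((v i - dot p v) ^ 2) ^ 2 - (dot p (fun i => (v i - dot p v) ^ 2)) ^ 2 := rfl
    linarith
  have ht : 0 ≤ ι / n := div_nonneg hι hn.le
  have hs : Real.sqrt (2 * pVar p (fun i => (v i - dot p v) ^ 2) * ι / n)
      ≤ pVar p v / 2 + Z ^ 2 * (ι / n) := by
    apply Real.sqrt_le_iff.2
    refine ⟨by positivity, ?_⟩
    have h1 := mul_le_mul_of_nonneg_right hW ht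
    rw [mul_div_assoc]
    nlinarith [sq_nonneg (pVar p v / 2 - Z ^ 2 * (ι / n))]
  have e1 : Z ^ 2 * ι / (3 * n) = Z ^ 2 * (ι / n) / 3 := by field_simp
  have e2 : 4 * Z ^ 2 * ι / (3 * n) = 4 * (Z ^ 2 * (ι / n)) / 3 := by field_simp
  rw [hd, e1] at h
  rw [e2]
  have h' := (abs_le.1 h).2
  nlinarith [sq_nonneg (dot phat v - dot p v)]
end

section
/- Consider a finite-horizon MDP (S, A, H, P, r, s₁) with r ≥ 0. Let P̂ assign to each pair (s,a) ∈ S×A a probability vector P̂_{s,a} on S, let B > 0 be a real number, and let b_h : S×A → ℝ for h ∈ {1,…,H}. Define Q_h and V_h backwards by V_{H+1} ≡ 0, Q_h(s,a) = min{ r(s,a) + P̂_{s,a}·V_{h+1} + b_h(s,a), B }, and V_h(s) = max_a Q_h(s,a). Assume (i) Q*_h(s,a) ≤ B for all (s,a) and all h ∈ {1,…,H}, and (ii) b_h(s,a) ≥ |(P̂_{s,a} − P_{s,a})·V_{h+1}| for all (s,a) and all h ∈ {1,…,H}. Then Q_h(s,a) ≥ Q*_h(s,a) for all (s,a) and all h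 ∈ {1,…,H}. -/
open Finset

/-- Generic optimism principle: the clipped optimistic backward recursion computed
with an empirical kernel `P̂` and any bonus dominating the kernel estimation error
pointwise dominates the true optimal Q-function, provided the clipping level `B`
dominates the optimal Q-function. -/
theorem optimism_generic
    {S A : Type*} [Fintype S] [Fintype A] [Nonempty A]
    (H : ℕ) (P : S → A → S → ℝ)
    (hP : ∀ s a, (∀ s', 0 ≤ P s a s') ∧ ∑ s', P s a s' = 1)
    (r : S → A → ℝ) (hr : ∀ s a, 0 ≤ r s a) (s₁ : S)
    -- the optimal value functions of the MDP, defined by backward recursion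
    (Qstar : ℕ → S → A → ℝ) (Vstar : ℕ → S → ℝ)
    (hVstarH : ∀ s, Vstar (H + 1) s = 0)
    (hQstar : ∀ h, 1 ≤ h → h ≤ H → ∀ s a,
      Qstar h s a = r s a + ∑ s', P s a s' * Vstar (h + 1) s')
    (hVstar : ∀ h, 1 ≤ h → h ≤ H → ∀ s, Vstar h s = ⨆ a, Qstar h s a)
    -- the empirical kernel, the clipping level and the bonuses
    (Phat : S → A → S → ℝ)
    (hPhat : ∀ s a, (∀ s', 0 ≤ Phat s a s') ∧ ∑ s', Phat s a s' = 1)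
    (B : ℝ) (hB : 0 < B) (b : ℕ → S → A → ℝ)
    -- the clipped optimistic backward recursion
    (Q : ℕ → S → A → ℝ) (V : ℕ → S → ℝ)
    (hVH : ∀ s, V (H + 1) s = 0)
    (hQ : ∀ h, 1 ≤ h → h ≤ H → ∀ s a,
      Q h s a = min (r s a + ∑ s', Phat s a s' * V (h + 1) s' + b h s a) B)
    (hV : ∀ h, 1 ≤ h → h ≤ H → ∀ s, V h s = ⨆ a, Q h s a)
    -- assumption (i): the clipping level dominates the optimal Q-function
    (hQstarB : ∀ h, 1 ≤ h → h ≤ H → ∀ s a, Qstar h s a ≤ B)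
    -- assumption (ii): the bonus dominates the estimation error
    (hb : ∀ h, 1 ≤ h → h ≤ H → ∀ s a,
      |∑ s', (Phat s a s' - P s a s') * V (h + 1) s'| ≤ b h s a) :
    ∀ h, 1 ≤ h → h ≤ H → ∀ s a, Qstar h s a ≤ Q h s a := by
  have step : ∀ h, 1 ≤ h → h ≤ H → (∀ s, Vstar (h + 1) s ≤ V (h + 1) s) →
      ∀ s a, Qstar h s a ≤ Q h s a := by
    intro h h1 hH hle s a
    rw [hQ h h1 hH s a]
    refine le_min ?_ (hQstarB h h1 hH s a)
    rw [hQstar h h1 hH s a]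
    have e1 : ∑ s', P s a s' * Vstar (h + 1) s' ≤ ∑ s', P s a s' * V (h + 1) s' :=
      Finset.sum_le_sum fun s' _ => mul_le_mul_of_nonneg_left (hle s') ((hP s a).1 s')
    have e2 := (abs_le.mp (hb h h1 hH s a)).1
    simp only [sub_mul, Finset.sum_sub_distrib] at e2
    linarith
  have key : ∀ k h, h + k = H + 1 → 1 ≤ h → ∀ s, Vstar h s ≤ V h s := by
    intro k
    induction k with
    | zero =>
      intro h hk _ s
      obtain rfl : h = H + 1 := by omega
      rw [hVstarH, hVH]
    | succ k ih =>
      intro h hk h1 s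
      have hH : h ≤ H := by omega
      rw [hVstar h h1 hH, hV h h1 hH]
      exact ciSup_mono (Set.finite_range _).bddAbove
        (step h h1 hH (ih (h + 1) (by omega) (by omega)) s)
  intro h h1 hH
  exact step h h1 hH (key (H - h) (h + 1) (by omega) (by omega))
end

section
/- Let p and p̂ be probability vectors on the finite set {1,…,S}, let v ∈ ℝ^S with 0 ≤ vᵢ ≤ 1 for all i, and let r ≥ 0, n > 0, ι ∈ [0, n] and ε₁ ∈ [0, 1] be reals. Assume (i) |(p̂ − p)·v| ≤ √(2·𝕍(p,v)·ι/n) + ι/(3n) + 3ε₁ and (ii) 𝕍(p̂, v) ≤ (3/2)·𝕍(p, v) + 4ι/(3n) + 3ε₁. Let b = 2·√(𝕍(p̂, v)·ι/n) + 14ι/(3n) and Q = min{ r + p̂·v + b, 1 } + 3ε₁. Then Q − r − p·v ≤ 4·√(𝕍(p, v)·ι/n) + 8ι/n + 6ε₁ + 4·√ε₁. -/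
open Finset

/-- Single state-action Bellman-error bound for the empirical-Bernstein-bonus backup:
the optimistic backup `Q` exceeds the true one-step backup `r + p·v` by at most a
quantity governed by the true variance `𝕍(p,v)` and lower-order terms. -/
theorem bellman_error_single_step
    (S : ℕ) (p phat : Fin S → ℝ)
    (hp : (∀ i, 0 ≤ p i) ∧ ∑ i, p i = 1)
    (hphat : (∀ i, 0 ≤ phat i) ∧ ∑ i, phat i = 1)
    (v : Fin S → ℝ) (hv : ∀ i, 0 ≤ v i ∧ v i ≤ 1)
    (r n ι ε₁ : ℝ) (hr : 0 ≤ r) (hn : 0 < n)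
    (hι : ι ∈ Set.Icc (0 : ℝ) n) (hε₁ : ε₁ ∈ Set.Icc (0 : ℝ) 1)
    (hconc : |dot (fun i => phat i - p i) v| ≤
      Real.sqrt (2 * pVar p v * ι / n) + ι / (3 * n) + 3 * ε₁)
    (hvarcmp : pVar phat v ≤ 3 / 2 * pVar p v + 4 * ι / (3 * n) + 3 * ε₁)
    (b Q : ℝ)
    (hb : b = 2 * Real.sqrt (pVar phat v * ι / n) + 14 * ι / (3 * n))
    (hQ : Q = min (r + dot phat v + b) 1 + 3 * ε₁) :
    Q - r - dot p v ≤
      4 * Real.sqrt (pVar p v * ι / n) + 8 * ι / n + 6 * ε₁ + 4 * Real.sqrt ε₁ := by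
  obtain ⟨hι0, hιn⟩ := hι
  obtain ⟨hε0, hε1⟩ := hε₁
  have hd : dot (fun i => phat i - p i) v = dot phat v - dot p v := by
    simp [dot, sub_mul, Finset.sum_sub_distrib]
  rw [hd] at hconc
  obtain ⟨x, hx⟩ : ∃ x, x = ι / n := ⟨_, rfl⟩
  have hx0 : 0 ≤ x := hx ▸ div_nonneg hι0 hn.le
  have hx1 : x ≤ 1 := by rw [hx]; exact (div_le_one hn).2 hιn
  have e1 : 2 * pVar p v * ι / n = 2 * (pVar p v * x) := by rw [hx]; ring
  have e2 : ι / (3 * n) = x / 3 := by rw [hx]; field_simp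
  have e3 : 4 * ι / (3 * n) = 4 / 3 * x := by rw [hx]; field_simp
  have e4 : 14 * ι / (3 * n) = 14 / 3 * x := by rw [hx]; field_simp
  have e5 : pVar phat v * ι / n = pVar phat v * x := by rw [hx]; ring
  have e6 : pVar p v * ι / n = pVar p v * x := by rw [hx]; ring
  have e7 : 8 * ι / n = 8 * x := by rw [hx]; ring
  rw [e1, e2] at hconc
  rw [e3] at hvarcmp
  rw [e4, e5] at hb
  rw [e6, e7]
  generalize pVar p v = V at *
  generalize pVar phat v = W at *
  have hA0 := Real.sqrt_nonneg (V * x)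
  have hA : V * x ≤ Real.sqrt (V * x) ^ 2 := by
    rcases le_total 0 (V * x) with h | h
    · rw [Real.sq_sqrt h]
    · exact h.trans (sq_nonneg _)
  have he0 := Real.sqrt_nonneg ε₁
  have he : ε₁ = Real.sqrt ε₁ ^ 2 := (Real.sq_sqrt hε0).symm
  generalize Real.sqrt (V * x) = A at *
  have h1 : Real.sqrt (2 * (V * x)) ≤ 1.415 * A := by
    apply Real.sqrt_le_iff.2
    constructor
    · positivity
    · nlinarith [sq_nonneg A]
  have h2 : Real.sqrt (W * x) ≤ 1.29 * A + 1.5 * x + 2 * Real.sqrt ε₁ := by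
    generalize Real.sqrt ε₁ = e at *
    apply Real.sqrt_le_iff.2
    constructor
    · positivity
    · have := mul_le_mul_of_nonneg_right hvarcmp hx0
      have h3 : ε₁ * x ≤ e ^ 2 := by nlinarith
      nlinarith [mul_nonneg hA0 hx0, mul_nonneg hA0 he0, mul_nonneg hx0 he0, sq_nonneg A, sq_nonneg x, sq_nonneg e]
  have h3 := min_le_left (r + dot phat v + b) 1
  have h4 := le_abs_self (dot phat v - dot p v)
  linarith
end

section
/- Consider a finite-horizon MDP M = (S, A, H, P, r, s₁) with r ≥ 0, and suppose that Σ_{h=1}^{H} r(s_h, a_h) ≤ 1 for every sequence ((s_1,a_1), …, (s_H,a_H)) ∈ (S×A)^H such that s_1 = s₁ and P_{s_h,a_h}(s_{h+1}) > 0 for all 1 ≤ h ≤ H−1. Let S×A = X₁ ∪ … ∪ X_{K+1} be a partition into pairwise disjoint sets and let Z₁, …, Z_{K+1} ≥ 1 be reals. Define the auxiliary MDP M† on state space S ∪ {s_end}, where s_end is a new state, with the same action set and horizon, transitions P†_{s,a} = (1 − 1/Z_i)·P_{s,a} + (1/Z_i)·δ_{s_end} for (s,a) ∈ X_i, P†_{s_end,a}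 = δ_{s_end} for every action a, reward r† equal to r on S×A and r†(s_end, a) = 0, and initial state s₁. Then for every deterministic policy π: V^{†π}₁(s₁) ≤ V^π₁(s₁) ≤ V^{†π}₁(s₁) + Σ_{i=1}^{K+1} ℙ_{π,M}[ Σ_{h=1}^H 𝟙[(s_h,a_h) ∈ X_i] > Z_i ] + Σ_{i=1}^{K+1} (1/Z_i)·𝔼_{π,M}[ min{ Σ_{h=1}^H 𝟙[(s_h,a_h) ∈ X_i], Z_i } ], where V^π and V^{†π} are the value functions of π in M and in M† respectively, and ℙ_{π,M}, 𝔼_{π,M} refer to the trajectory distribution of π in M. -/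
open Finset


noncomputable def trE {S : Type*} [Fintype S] [DecidableEq S] (n : ℕ) (Q : ℕ → S → S → ℝ) (s : S)
    (f : (Fin (n + 1) → S) → ℝ) : ℝ :=
  ∑ t : Fin (n + 1) → S, ((if t 0 = s then 1 else 0) *
    ∏ h : Fin n, Q (h : ℕ) (t h.castSucc) (t h.succ)) * f t

noncomputable def trG {S : Type*} : (n : ℕ) → (ℕ → S → ℝ) → (ℕ → S → ℝ) → (Fin (n + 1) → S) → ℝ
  | 0, _, _, _ => 0
  | n + 1, c, r, t => r 0 (t 0) +
      c 0 (t 0) * trG n (fun h => c (h + 1)) (fun h => r (h + 1)) (fun j => t j.succ)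

theorem trE_succ {S : Type*} [Fintype S] [DecidableEq S] (n : ℕ) (Q : ℕ → S → S → ℝ) (s : S)
    (f : (Fin (n + 2) → S) → ℝ) :
    trE (n + 1) Q s f = ∑ s', Q 0 s s' *
      trE n (fun h => Q (h + 1)) s' (fun t => f (Fin.cons s t)) := by
  unfold trE
  rw [← (Fin.consEquiv (fun _ : Fin (n + 2) => S)).sum_comp, Fintype.sum_prod_type]
  simp only [Fin.consEquiv_apply, Fin.cons_zero, Finset.mul_sum]
  rw [Finset.sum_eq_single s (by intro b _ hb; simp [hb]) (by simp), Finset.sum_comm]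
  refine Finset.sum_congr rfl fun t _ => ?_
  rw [Finset.sum_eq_single (t 0) (by intro b _ hb; simp [Ne.symm hb]) (by simp)]
  rw [Fin.prod_univ_succ]
  have e : (Fin.consEquiv (fun _ : Fin (n + 2) => S)) (s, t) = Fin.cons s t := rfl
  rw [e]
  simp [Fin.castSucc_succ]
  ring

theorem trE_one {S : Type*} [Fintype S] [DecidableEq S] (n : ℕ) (Q : ℕ → S → S → ℝ) (s : S)
    (hQ : ∀ h s, ∑ s', Q h s s' = 1) : trE n Q s (fun _ => 1) = 1 := by
  induction n generalizing Q s with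
  | zero =>
    unfold trE
    rw [← (Equiv.funUnique (Fin 1) S).symm.sum_comp]
    simp
  | succ n ih =>
    rw [trE_succ]
    simp only [ih (fun h => Q (h + 1)) _ (fun h => hQ (h + 1)), mul_one, hQ]

theorem trE_affine {S : Type*} [Fintype S] [DecidableEq S] (n : ℕ) (Q : ℕ → S → S → ℝ) (s : S)
    (a b : ℝ) (f : (Fin (n + 1) → S) → ℝ) :
    trE n Q s (fun t => a + b * f t) = a * trE n Q s (fun _ => 1) + b * trE n Q s f := by
  unfold trE
  rw [Finset.mul_sum, Finset.mul_sum, ← Finset.sum_add_distrib]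
  refine Finset.sum_congr rfl fun t _ => ?_
  ring

theorem trE_value {S : Type*} [Fintype S] [DecidableEq S] (n : ℕ) (Q : ℕ → S → S → ℝ) (s : S)
    (hQ : ∀ h s, ∑ s', Q h s s' = 1) (c r W : ℕ → S → ℝ) (hW0 : ∀ s, W n s = 0)
    (hW : ∀ h < n, ∀ s, W h s = r h s + c h s * ∑ s', Q h s s' * W (h + 1) s') :
    W 0 s = trE n Q s (trG n c r) := by
  induction n generalizing Q s c r W with
  | zero => simp [hW0, trE, trG]
  | succ n ih =>
    have key := fun s' => ih (fun h => Q (h + 1)) s' (fun h => hQ (h + 1)) (fun h => c (h + 1))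
      (fun h => r (h + 1)) (fun h => W (h + 1)) hW0 (fun h hh => hW (h + 1) (by omega))
    simp only [zero_add] at key
    rw [trE_succ, hW 0 (by omega)]
    simp only [trG, Fin.cons_zero, Fin.cons_succ]
    simp only [trE_affine, trE_one _ _ _ (fun h => hQ (h + 1)), ← key, zero_add]
    simp only [mul_add, Finset.sum_add_distrib, mul_one, ← Finset.sum_mul, hQ, one_mul,
      Finset.mul_sum]
    congr 1
    refine Finset.sum_congr rfl fun t _ => ?_
    ring

theorem trG_one {S : Type*} (n : ℕ) (r : ℕ → S → ℝ) (t : Fin (n + 1) → S) :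
    trG n (fun _ _ => 1) r t = ∑ h : Fin n, r h (t h.castSucc) := by
  induction n generalizing r with
  | zero => simp [trG]
  | succ n ih =>
    rw [trG, ih, Fin.sum_univ_succ]
    simp

theorem trG_bd {S : Type*} (n : ℕ) (c r : ℕ → S → ℝ) (hr : ∀ h s, 0 ≤ r h s)
    (hc0 : ∀ h s, 0 ≤ c h s) (hc1 : ∀ h s, c h s ≤ 1) (t : Fin (n + 1) → S) :
    0 ≤ trG n c r t ∧ trG n c r t ≤ trG n (fun _ _ => 1) r t ∧
    0 ≤ ∑ h : Fin n, (1 - c h (t h.castSucc)) ∧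
    trG n (fun _ _ => 1) r t - trG n c r t ≤
      (∑ h : Fin n, (1 - c h (t h.castSucc))) * trG n (fun _ _ => 1) r t := by
  induction n generalizing c r with
  | zero => simp [trG]
  | succ n ih =>
    obtain ⟨h1, h2, h3, h4⟩ := ih (fun h => c (h + 1)) (fun h => r (h + 1))
      (fun h => hr _) (fun h => hc0 _) (fun h => hc1 _) (fun j => t j.succ)
    rw [Fin.sum_univ_succ]
    simp only [trG]
    simp only [Fin.castSucc_zero, Fin.val_succ, Fin.val_zero, ← Fin.succ_castSucc] at *
    generalize trG n (fun h => c (h + 1)) (fun h => r (h + 1)) (fun j => t j.succ) = x at *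
    generalize trG n (fun _ _ => 1) (fun h => r (h + 1)) (fun j => t j.succ) = y at *
    generalize (∑ h : Fin n, (1 - c (h + 1) (t h.castSucc.succ))) = z at *
    have hr0 := hr 0 (t 0)
    have ha := hc0 0 (t 0)
    have hb := hc1 0 (t 0)
    generalize r 0 (t 0) = ρ at *
    generalize c 0 (t 0) = γ at *
    have e1 := mul_nonneg ha h1
    have e2 : 0 ≤ (1 - γ) * x := mul_nonneg (by linarith) h1
    have e3 : 0 ≤ (1 - γ + z) * ρ := mul_nonneg (by linarith) hr0
    have e4 : 0 ≤ (1 - γ) * (y - x) := mul_nonneg (by linarith) (by linarith)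
    refine ⟨by linarith, by nlinarith, by linarith, by nlinarith⟩

/-- Soft-truncation approximation lemma: redirecting a `1/Zᵢ` fraction of every
transition out of `Xᵢ` to an absorbing zero-reward state `s_end` changes the value of
any policy by at most the sum over `i` of the probability of visiting `Xᵢ` more than
`Zᵢ` times plus the normalized truncated expected number of visits to `Xᵢ`. -/
theorem soft_truncation_approximation
    {S A : Type*} [Fintype S] [Fintype A] [Nonempty A] [DecidableEq S] [DecidableEq A]
    (H : ℕ) (hH : 0 < H) (K : ℕ)
    (P : S → A → S → ℝ)
    (hP : ∀ s a, (∀ s', 0 ≤ P s a s') ∧ ∑ s', P s a s' = 1)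
    (r : S → A → ℝ) (hr : ∀ s a, 0 ≤ r s a) (s₁ : S)
    -- the total reward along every feasible trajectory is at most 1
    (hrtot : ∀ t : Fin H → S × A, (t ⟨0, hH⟩).1 = s₁ →
      (∀ (h : ℕ) (h1 : h + 1 < H),
        0 < P (t ⟨h, by omega⟩).1 (t ⟨h, by omega⟩).2 (t ⟨h + 1, h1⟩).1) →
      ∑ h, r (t h).1 (t h).2 ≤ 1)
    -- the partition `S×A = X₁ ∪ … ∪ X_{K+1}` and the thresholds `Zᵢ ≥ 1`
    (X : Fin (K + 1) → Finset (S × A))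
    (hXdisj : ∀ i j, i ≠ j → Disjoint (X i) (X j))
    (idx : S → A → Fin (K + 1)) (hidx : ∀ s a, (s, a) ∈ X (idx s a))
    (Z : Fin (K + 1) → ℝ) (hZ : ∀ i, 1 ≤ Z i)
    -- a deterministic policy
    (π : ℕ → S → A)
    -- the value functions of `π` in the original MDP `M`
    (Vπ : ℕ → S → ℝ)
    (hVπH : ∀ s, Vπ (H + 1) s = 0)
    (hVπ : ∀ h, 1 ≤ h → h ≤ H → ∀ s,
      Vπ h s = r s (π h s) + ∑ s', P s (π h s) s' * Vπ (h + 1) s')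
    -- the value functions of `π` in the auxiliary MDP `M†` on `S ∪ {s_end}`, where a
    -- `1/Z_{i(s,a)}` fraction of each transition is redirected to the absorbing
    -- zero-reward state `s_end`
    (Vd : ℕ → S ⊕ Unit → ℝ)
    (hVdH : ∀ x, Vd (H + 1) x = 0)
    (hVdend : ∀ h, 1 ≤ h → h ≤ H → ∀ u : Unit, Vd h (Sum.inr u) = 0 + Vd (h + 1) (Sum.inr u))
    (hVd : ∀ h, 1 ≤ h → h ≤ H → ∀ s,
      Vd h (Sum.inl s) = r s (π h s) +
        ((∑ s', (1 - 1 / Z (idx s (π h s))) * P s (π h s) s' * Vd (h + 1) (Sum.inl s')) +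
          (1 / Z (idx s (π h s))) * Vd (h + 1) (Sum.inr ())))
    -- the trajectory distribution of `π` in `M`: `t j` is the state `s_{j+1}`,
    -- and the action at step `h` is `π h s_h`
    (prob : (Fin (H + 1) → S) → ℝ)
    (hprob : ∀ t, prob t = (if t 0 = s₁ then 1 else 0) *
      ∏ h : Fin H, P (t h.castSucc) (π ((h : ℕ) + 1) (t h.castSucc)) (t h.succ))
    -- the number of visits to `Xᵢ` along a trajectory
    (cnt : Fin (K + 1) → (Fin (H + 1) → S) → ℝ)
    (hcnt : ∀ i t, cnt i t =
      ∑ h : Fin H,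
        if (t h.castSucc, π ((h : ℕ) + 1) (t h.castSucc)) ∈ X i then (1 : ℝ) else 0) :
    Vd 1 (Sum.inl s₁) ≤ Vπ 1 s₁ ∧
    Vπ 1 s₁ ≤ Vd 1 (Sum.inl s₁) +
      (∑ i : Fin (K + 1), ∑ t : Fin (H + 1) → S,
        prob t * (if Z i < cnt i t then (1 : ℝ) else 0)) +
      (∑ i : Fin (K + 1), (1 / Z i) *
        ∑ t : Fin (H + 1) → S, prob t * min (cnt i t) (Z i)) := by
  have hr' : ∀ (h : ℕ) (s : S), 0 ≤ r s (π (h + 1) s) := fun h s => hr _ _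
  have hQ : ∀ (h : ℕ) (s : S), ∑ s', P s (π (h + 1) s) s' = 1 := fun h s => (hP _ _).2
  have hz1 : ∀ i, 1 / Z i ≤ 1 := fun i => by
    rw [div_le_one (by linarith [hZ i])]; exact hZ i
  have hz0 : ∀ i, 0 ≤ 1 / Z i := fun i => by
    have := hZ i
    positivity
  have hend : ∀ k, k ≤ H → Vd (H + 1 - k) (Sum.inr ()) = 0 := by
    intro k
    induction k with
    | zero => intro _; exact hVdH _
    | succ k ih =>
      intro hk
      rw [hVdend _ (by omega) (by omega), show H + 1 - (k + 1) + 1 = H + 1 - k by omega,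
        ih (by omega), zero_add]
  have eV := trE_value H (fun h s s' => P s (π (h + 1) s) s') s₁ hQ (fun _ _ => 1)
    (fun h s => r s (π (h + 1) s)) (fun h s => Vπ (h + 1) s) hVπH
    (fun h hh s => by
      show Vπ (h + 1) s = _
      rw [hVπ (h + 1) (by omega) (by omega), one_mul])
  have eD := trE_value H (fun h s s' => P s (π (h + 1) s) s') s₁ hQ
    (fun h s => 1 - 1 / Z (idx s (π (h + 1) s)))
    (fun h s => r s (π (h + 1) s)) (fun h s => Vd (h + 1) (Sum.inl s)) (fun s => hVdH _)
    (fun h hh s => by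
      show Vd (h + 1) (Sum.inl s) = _
      have h0 := hend (H + 1 - (h + 1 + 1)) (by omega)
      rw [show H + 1 - (H + 1 - (h + 1 + 1)) = h + 1 + 1 by omega] at h0
      rw [hVd (h + 1) (by omega) (by omega), h0, mul_zero, add_zero, Finset.mul_sum]
      congr 1
      exact Finset.sum_congr rfl fun s' _ => mul_assoc _ _ _)
  simp only [zero_add] at eV eD
  unfold trE at eV eD
  simp only [← hprob] at eV eD
  have bd := trG_bd H (fun h s => 1 - 1 / Z (idx s (π (h + 1) s)))
    (fun h s => r s (π (h + 1) s)) hr' (fun h s => by linarith [hz1 (idx s (π (h + 1) s))])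
    (fun h s => by linarith [hz0 (idx s (π (h + 1) s))])
  have pnn : ∀ t, 0 ≤ prob t := fun t => by
    rw [hprob]
    refine mul_nonneg (by split_ifs <;> norm_num) (Finset.prod_nonneg fun h _ => (hP _ _).1 _)
  have hcn : ∀ i t, 0 ≤ cnt i t := fun i t => by
    rw [hcnt]
    exact Finset.sum_nonneg fun h _ => by split_ifs <;> norm_num
  have hmem : ∀ s a i, (s, a) ∈ X i ↔ i = idx s a := by
    intro s a i
    constructor
    · intro h
      by_contra hne
      exact Finset.disjoint_left.mp (hXdisj _ _ hne) h (hidx s a)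
    · rintro rfl
      exact hidx s a
  have hsum : ∀ t : Fin (H + 1) → S, ∑ h : Fin H,
      (1 - (1 - 1 / Z (idx (t h.castSucc) (π ((h : ℕ) + 1) (t h.castSucc))))) =
      ∑ i, (1 / Z i) * cnt i t := by
    intro t
    simp only [hcnt, Finset.mul_sum]
    rw [Finset.sum_comm]
    refine Finset.sum_congr rfl fun h _ => ?_
    simp [hmem]
  have hR : ∀ t, prob t ≠ 0 →
      trG H (fun _ _ => 1) (fun h s => r s (π (h + 1) s)) t ≤ 1 := by
    intro t ht
    rw [trG_one]
    rw [hprob] at ht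
    have hA := left_ne_zero_of_mul ht
    have hB := right_ne_zero_of_mul ht
    rw [Finset.prod_ne_zero_iff] at hB
    refine hrtot (fun h => (t h.castSucc, π ((h : ℕ) + 1) (t h.castSucc))) ?_ ?_
    · by_contra hne
      exact hA (if_neg hne)
    · intro h h1
      exact lt_of_le_of_ne ((hP _ _).1 _) (Ne.symm (hB ⟨h, by omega⟩ (Finset.mem_univ _)))
  constructor
  · rw [eV, eD]
    exact Finset.sum_le_sum fun t _ => mul_le_mul_of_nonneg_left (bd t).2.1 (pnn t)
  · rw [eV, eD]
    simp only [Finset.mul_sum]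
    rw [Finset.sum_comm, Finset.sum_comm (s := (Finset.univ : Finset (Fin (K + 1)))),
      ← Finset.sum_add_distrib, ← Finset.sum_add_distrib]
    refine Finset.sum_le_sum fun t _ => ?_
    by_cases hp : prob t = 0
    · simp [hp]
    have key : trG H (fun _ _ => 1) (fun h s => r s (π (h + 1) s)) t ≤
        trG H (fun h s => 1 - 1 / Z (idx s (π (h + 1) s))) (fun h s => r s (π (h + 1) s)) t +
        (∑ i, if Z i < cnt i t then (1 : ℝ) else 0) + ∑ i, (1 / Z i) * min (cnt i t) (Z i) := by
      obtain ⟨b1, b2, b3, b4⟩ := bd t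
      rw [hsum] at b3 b4
      have hR1 := hR t hp
      have n1 : ∀ i, (0 : ℝ) ≤ if Z i < cnt i t then (1 : ℝ) else 0 := fun i => by
        split_ifs <;> norm_num
      have n2 : ∀ i, 0 ≤ (1 / Z i) * min (cnt i t) (Z i) := fun i =>
        mul_nonneg (hz0 i) (le_min (hcn i t) (by linarith [hZ i]))
      have N1 := Finset.sum_nonneg fun i (_ : i ∈ Finset.univ) => n1 i
      have N2 := Finset.sum_nonneg fun i (_ : i ∈ Finset.univ) => n2 i
      by_cases hex : ∃ i, Z i < cnt i t
      · obtain ⟨i, hi⟩ := hex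
        have := Finset.single_le_sum (fun i _ => n1 i) (Finset.mem_univ i)
        rw [if_pos hi] at this
        linarith
      · push Not at hex
        have : ∑ i, (1 / Z i) * min (cnt i t) (Z i) = ∑ i, (1 / Z i) * cnt i t :=
          Finset.sum_congr rfl fun i _ => by rw [min_eq_left (hex i)]
        rw [this]
        have := mul_le_mul_of_nonneg_left hR1 b3
        linarith
    refine (mul_le_mul_of_nonneg_left key (pnn t)).trans (le_of_eq ?_)
    rw [mul_add, mul_add, Finset.mul_sum, Finset.mul_sum]
    congr 1
    exact Finset.sum_congr rfl fun i _ => by ring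
end
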